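/- arXiv:1803.09384 — 2 statements merged into one kernel-verified Lean document; each statement's English description precedes it below -/
import Mathlib

section
/- Let 𝒮 be an o-minimal structure on ℝ containing all ℝ_an-definable sets. Let f : ℂ^n → ℂ^m be a holomorphic map whose graph, viewed as a subset of ℝ^{2(n+m)}, is 𝒮-definable. Then each coordinate function of f is a polynomial in z_1, …, z_n with complex coefficients. -/
/-- A basic semialgebraic set / finite unions thereof. -/
def IsSemialgebraic {m : ℕ} (A : Set (Fin m → ℝ)) : Prop :=
  ∃ (k : ℕ) (B : Fin k → Set (Fin m → ℝ)),
    (∀ i, ∃ (p : MvPolynomial (Fin m) ℝ) (r : ℕ) (q : Fin r → MvPolynomial (Fin m) ℝ),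
      B i = {x | MvPolynomial.eval x p = 0 ∧ ∀ j, 0 < MvPolynomial.eval x (q j)}) ∧
    A = ⋃ i, B i

/-- A structure on ℝ in the sense of model theory. -/
structure RStructure where
  defin : (m : ℕ) → Set (Set (Fin m → ℝ))
  algebraic_mem : ∀ (m : ℕ) (p : MvPolynomial (Fin m) ℝ),
    {x | MvPolynomial.eval x p = 0} ∈ defin m
  union_mem : ∀ (m : ℕ) (A B : Set (Fin m → ℝ)),
    A ∈ defin m → B ∈ defin m → A ∪ B ∈ defin m
  inter_mem : ∀ (m : ℕ) (A B : Set (Fin m → ℝ)),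
    A ∈ defin m → B ∈ defin m → A ∩ B ∈ defin m
  compl_mem : ∀ (m : ℕ) (A : Set (Fin m → ℝ)), A ∈ defin m → Aᶜ ∈ defin m
  prod_mem : ∀ (m k : ℕ) (A : Set (Fin m → ℝ)) (B : Set (Fin k → ℝ)),
    A ∈ defin m → B ∈ defin k →
    {x : Fin (m + k) → ℝ |
      (fun i => x (Fin.castAdd k i)) ∈ A ∧ (fun j => x (Fin.natAdd m j)) ∈ B} ∈ defin (m + k)
  proj_mem : ∀ (m : ℕ) (A : Set (Fin (m + 1) → ℝ)), A ∈ defin (m + 1) →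
    (fun x : Fin (m + 1) → ℝ => x ∘ Fin.castSucc) '' A ∈ defin m

/-- Restricted analytic function on ℝ^m. -/
def IsRestrictedAnalytic {m : ℕ} (f : (Fin m → ℝ) → ℝ) : Prop :=
  (∀ x, x ∉ Set.Icc (0 : Fin m → ℝ) 1 → f x = 0) ∧
  ∃ (U : Set (Fin m → ℝ)) (g : (Fin m → ℝ) → ℝ), IsOpen U ∧ Set.Icc (0 : Fin m → ℝ) 1 ⊆ U ∧
    AnalyticOnNhd ℝ g U ∧ Set.EqOn f g (Set.Icc (0 : Fin m → ℝ) 1)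

/-- The graph of a real valued function on ℝ^m, as a subset of ℝ^{m+1}. -/
def graphSet {m : ℕ} (f : (Fin m → ℝ) → ℝ) : Set (Fin (m + 1) → ℝ) :=
  {x | x (Fin.last m) = f (x ∘ Fin.castSucc)}

/-- A structure contains all semialgebraic sets and all graphs of restricted analytic
functions. -/
def RStructure.HasRan (S : RStructure) : Prop :=
  (∀ (m : ℕ) (A : Set (Fin m → ℝ)), IsSemialgebraic A → A ∈ S.defin m) ∧
  (∀ (m : ℕ) (f : (Fin m → ℝ) → ℝ), IsRestrictedAnalytic f → graphSet f ∈ S.defin (m + 1))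

/-- A set is ℝ_an-definable if it belongs to every structure containing the semialgebraic
sets and the graphs of restricted analytic functions, i.e. if it is definable in the smallest
such structure. -/
def IsRanDefinable {m : ℕ} (A : Set (Fin m → ℝ)) : Prop :=
  ∀ S : RStructure, S.HasRan → A ∈ S.defin m

/-- A subset of ℝ which is a finite union of points and open intervals. -/
def IsFinUnionPtsIntervals (A : Set ℝ) : Prop :=
  ∃ (k : ℕ) (B : Fin k → Set ℝ),
    (∀ i, (∃ a, B i = {a}) ∨ (∃ a b, B i = Set.Ioo a b) ∨ (∃ a, B i = Set.Ioi a) ∨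
      (∃ a, B i = Set.Iio a) ∨ B i = Set.univ) ∧
    A = ⋃ i, B i

/-- A structure is o-minimal if the definable subsets of ℝ are exactly the finite unions of
points and open intervals. -/
def RStructure.IsOMinimal (S : RStructure) : Prop :=
  ∀ A : Set (Fin 1 → ℝ), A ∈ S.defin 1 ↔ IsFinUnionPtsIntervals ((fun x => x 0) '' A)

/-- The identification of ℂ^n with ℝ^{2n}, listing real parts then imaginary parts. -/
def c2r {n : ℕ} (z : Fin n → ℂ) : Fin (n + n) → ℝ :=
  Fin.append (fun i => (z i).re) (fun i => (z i).im)

section EntireFunctions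

open Filter Topology Set Bornology

/-- An entire function of polynomial growth is a polynomial. -/
theorem Differentiable.exists_polynomial_of_isBigO {g : ℂ → ℂ} (hg : Differentiable ℂ g) {k : ℕ}
    (h : g =O[cobounded ℂ] fun t => t ^ k) :
    ∃ p : Polynomial ℂ, ∀ t, g t = p.eval t := by
  have hzero : ∀ n, k < n → iteratedDeriv n g 0 = 0 := by
    intro n hn
    obtain ⟨C, hC⟩ := h.bound
    rw [← comap_norm_atTop, eventually_comap] at hC
    have hlim : Tendsto (fun R : ℝ => (n.factorial * C) * (R ^ (n - k))⁻¹) atTop (𝓝 0) := by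
      have := (tendsto_pow_atTop (α := ℝ) (n := n - k) (by omega)).inv_tendsto_atTop
      simpa using this.const_mul (n.factorial * C : ℝ)
    refine norm_le_zero_iff.1 (ge_of_tendsto hlim ?_)
    filter_upwards [hC, eventually_gt_atTop 0] with R hR hpos
    refine (Complex.norm_iteratedDeriv_le_of_forall_mem_sphere_norm_le (C := C * R ^ k) n hpos
      hg.diffContOnCl fun z hz => ?_).trans_eq ?_
    · have hz' : ‖z‖ = R := by simpa using hz
      simpa [hz'] using hR z hz'
    · rw [← Nat.add_sub_of_le hn.le, pow_add, Nat.add_sub_cancel_left]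
      field_simp
  refine ⟨∑ n ∈ Finset.range (k + 1),
    Polynomial.C ((n.factorial : ℂ)⁻¹ * iteratedDeriv n g 0) * Polynomial.X ^ n, fun t => ?_⟩
  rw [← Complex.taylorSeries_eq_of_entire' 0 t hg, tsum_eq_sum (s := Finset.range (k + 1))]
  · simp [Polynomial.eval_finsetSum]
  · intro n hn
    rw [hzero n (by simpa using hn)]
    simp

/-- **Casorati–Weierstrass** at infinity for entire functions. -/
theorem Differentiable.dense_image_norm_gt {g : ℂ → ℂ} (hg : Differentiable ℂ g)
    (hp : ¬∃ p : Polynomial ℂ, ∀ t, g t = p.eval t) (R : ℝ) : Dense (g '' {t | R < ‖t‖}) := by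
  rw [Metric.dense_iff]
  by_contra! hcon
  obtain ⟨w, ε, hε, hdisj⟩ := hcon
  have hfar : ∀ t, R < ‖t‖ → ε ≤ ‖g t - w‖ := by
    intro t ht
    by_contra! hlt
    exact (hdisj ▸ (⟨mem_ball_iff_norm.2 hlt, t, ht, rfl⟩ :
      g t ∈ Metric.ball w ε ∩ g '' {t | R < ‖t‖}) : g t ∈ (∅ : Set ℂ))
  have hev : ∀ᶠ t in cobounded ℂ, ε ≤ ‖g t - w‖ := by
    rw [← comap_norm_atTop]
    filter_upwards [preimage_mem_comap (Ioi_mem_atTop R)] with t ht using hfar t ht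
  let q : ℂ → ℂ := fun ζ => (g ζ⁻¹ - w)⁻¹
  have hevq : ∀ᶠ ζ in 𝓝[≠] (0 : ℂ), ε ≤ ‖g ζ⁻¹ - w‖ :=
    tendsto_inv₀_nhdsNE_zero.eventually hev
  have hqd : ∀ᶠ ζ in 𝓝[≠] (0 : ℂ), DifferentiableAt ℂ q ζ := by
    filter_upwards [hevq, self_mem_nhdsWithin] with ζ h1 h2
    refine DifferentiableAt.inv ?_ (norm_pos_iff.1 (hε.trans_le h1))
    exact ((hg _).comp ζ (differentiableAt_inv h2)).sub_const w
  have hqb : IsBoundedUnder (· ≤ ·) (𝓝[≠] (0 : ℂ)) fun ζ => ‖q ζ - q 0‖ := by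
    refine ⟨ε⁻¹ + ‖q 0‖, eventually_map.2 ?_⟩
    filter_upwards [hevq] with ζ h1
    refine norm_sub_le_of_le ?_ le_rfl
    simpa [q] using inv_anti₀ hε h1
  have hlim := Complex.tendsto_limUnder_of_differentiable_on_punctured_nhds_of_bounded_under hqd hqb
  set a := limUnder (𝓝[≠] (0 : ℂ)) q
  have hana : AnalyticAt ℂ (Function.update q 0 a) 0 := by
    refine Complex.analyticAt_of_differentiable_on_punctured_nhds_of_continuousAt ?_
      (continuousAt_update_same.2 hlim)
    filter_upwards [hqd, self_mem_nhdsWithin] with ζ h1 h2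
    refine h1.congr_of_eventuallyEq ?_
    filter_upwards [isOpen_ne.mem_nhds h2] with x hx using Function.update_of_ne hx _ _
  have hne : ¬∀ᶠ ζ in 𝓝 (0 : ℂ), Function.update q 0 a ζ = 0 := by
    intro h0
    obtain ⟨ζ, h1, h2, h3⟩ :=
      ((h0.filter_mono nhdsWithin_le_nhds).and (hevq.and self_mem_nhdsWithin)).exists
    rw [Function.update_of_ne h3] at h1
    exact norm_pos_iff.1 (hε.trans_le h2) (inv_eq_zero.1 h1)
  obtain ⟨k, u, hu, hu0, hfac⟩ := hana.exists_eventuallyEq_pow_smul_nonzero_iff.2 hne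
  have hO : (fun ζ => g ζ⁻¹ - w) =O[𝓝[≠] (0 : ℂ)] fun ζ => ζ⁻¹ ^ k := by
    have hb : (fun ζ => (u ζ)⁻¹) =O[𝓝[≠] (0 : ℂ)] fun _ => (1 : ℂ) :=
      ((hu.continuousAt.inv₀ hu0).tendsto.mono_left nhdsWithin_le_nhds).isBigO_one ℂ
    refine ((Asymptotics.isBigO_refl (fun ζ : ℂ => ζ⁻¹ ^ k) _).mul hb).congr' ?_ (by simp)
    filter_upwards [hfac.filter_mono nhdsWithin_le_nhds, self_mem_nhdsWithin] with ζ h1 h2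
    rw [Function.update_of_ne h2, sub_zero, smul_eq_mul] at h1
    rw [← inv_inv (g ζ⁻¹ - w), show (g ζ⁻¹ - w)⁻¹ = _ from h1, mul_inv, inv_pow]
  have hO' : (fun t => g t - w) =O[cobounded ℂ] fun t => t ^ k := by
    have := hO.comp_tendsto tendsto_inv₀_cobounded'
    simpa [Function.comp_def] using this
  obtain ⟨p, hpe⟩ := (hg.sub_const w).exists_polynomial_of_isBigO hO'
  exact hp ⟨p + Polynomial.C w, fun t => by simp [← hpe t]⟩

theorem IsFinUnionPtsIntervals.bddAbove_of_countable {A : Set ℝ} (hA : IsFinUnionPtsIntervals A)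
    (hc : A.Countable) : BddAbove A := by
  obtain ⟨k, B, hB, rfl⟩ := hA
  refine (finite_iUnion fun i => ?_).bddAbove
  have hi : (B i).Countable := hc.mono (subset_iUnion B i)
  rcases hB i with ⟨a, h⟩ | ⟨a, b, h⟩ | ⟨a, h⟩ | ⟨a, h⟩ | h
  · simp [h]
  · rw [h, Cardinal.Real.Ioo_countable_iff] at hi
    simp [h, Ioo_eq_empty_of_le hi]
  · exact absurd (hi.mono (h ▸ Ioo_subset_Ioi_self : Ioo a (a + 1) ⊆ B i))
      (by simp [Cardinal.Real.Ioo_countable_iff])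
  · exact absurd (hi.mono (h ▸ Ioo_subset_Iio_self : Ioo (a - 1) a ⊆ B i))
      (by simp [Cardinal.Real.Ioo_countable_iff])
  · exact absurd (hi.mono (h ▸ subset_univ _ : Ioo 0 1 ⊆ B i))
      (by simp [Cardinal.Real.Ioo_countable_iff])

/-- The zeros of a non-constant entire function are countable. -/
theorem Differentiable.countable_fiber {g : ℂ → ℂ} (hg : Differentiable ℂ g) {c x : ℂ}
    (hx : g x ≠ c) : {t | g t = c}.Countable := by
  have hd : Differentiable ℂ fun t => g t - c := hg.sub_const c
  have hcod := AnalyticOnNhd.preimage_zero_mem_codiscrete (x := x)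
    (fun t _ => hd.analyticAt t) (sub_ne_zero.2 hx)
  have := isDiscrete_of_codiscreteWithin (s := {t | g t = c}) (U := univ) (by
    filter_upwards [hcod] with t ht using fun h => ht (sub_eq_zero.2 h))
  rw [inter_univ] at this
  exact (HereditarilyLindelofSpace.isLindelof _).countable_of_isDiscrete this

/-- An entire function is a polynomial if the squared moduli of the points of each fibre form a
finite union of points and intervals. -/
theorem Differentiable.exists_polynomial_of_fibers {g : ℂ → ℂ} (hg : Differentiable ℂ g)
    (h : ∀ c, IsFinUnionPtsIntervals (Complex.normSq '' {t | g t = c})) :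
    ∃ p : Polynomial ℂ, ∀ t, g t = p.eval t := by
  by_contra hp
  have hopen : IsOpenMap g := by
    refine (AnalyticOnNhd.is_constant_or_isOpenMap fun t _ => hg.analyticAt t).resolve_left ?_
    rintro ⟨w, hw⟩
    exact hp ⟨Polynomial.C w, by simpa using hw⟩
  have hdense : Dense (⋂ N : ℕ, g '' {t | (N : ℝ) < ‖t‖}) :=
    dense_iInter_of_isOpen_nat
      (fun N => hopen _ (isOpen_lt continuous_const continuous_norm))
      (fun N => hg.dense_image_norm_gt hp N)
  obtain ⟨c, hc⟩ := hdense.nonempty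
  obtain ⟨x, hx⟩ : ∃ x, g x ≠ c := by
    by_contra! hcon
    exact hp ⟨Polynomial.C c, by simpa using hcon⟩
  obtain ⟨M, hM⟩ := (h c).bddAbove_of_countable ((hg.countable_fiber hx).image _)
  obtain ⟨N, hN⟩ := exists_nat_ge (max M 1)
  obtain ⟨t, ht, htc⟩ := mem_iInter.1 hc N
  have h1 := hM (mem_image_of_mem _ (show t ∈ {t | g t = c} from htc))
  rw [Complex.normSq_eq_norm_sq] at h1
  have h2 : (N : ℝ) < ‖t‖ := ht
  have h3 := le_max_left M 1
  have h4 := le_max_right M 1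
  nlinarith

end EntireFunctions

section SeparatelyPolynomial

open Topology Set

/-- A continuous function on `ℂ^n` that is polynomial in each variable separately is polynomial. -/
theorem Continuous.exists_mvPolynomial_of_separately {n : ℕ} {g : (Fin n → ℂ) → ℂ}
    (hg : Continuous g)
    (h : ∀ z i, ∃ p : Polynomial ℂ, ∀ t, g (Function.update z i t) = p.eval t) :
    ∃ p : MvPolynomial (Fin n) ℂ, ∀ z, g z = MvPolynomial.eval z p := by
  induction n with
  | zero => exact ⟨MvPolynomial.C (g 0), fun z => by simp [Subsingleton.elim z 0]⟩
  | succ n ih =>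
    have hcons : Continuous fun yx : ℂ × (Fin n → ℂ) => g (Fin.cons yx.1 yx.2) :=
      hg.comp (Continuous.finCons (A := fun _ => ℂ) continuous_fst continuous_snd)
    have hslice : ∀ y : ℂ, ∃ p : MvPolynomial (Fin n) ℂ, ∀ x : Fin n → ℂ,
        g (Fin.cons y x) = MvPolynomial.eval x p := by
      intro y
      refine ih (g := fun x => g (Fin.cons y x))
        (hcons.comp (f := fun x => (y, x)) (by fun_prop)) fun x i => ?_
      obtain ⟨p, hp⟩ := h (Fin.cons y x) i.succ
      exact ⟨p, fun t => by rw [Fin.cons_update, hp]⟩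
    choose P hP using hslice
    let L : ℕ → ℕ → Polynomial ℂ := fun d => Lagrange.basis (Finset.range d) (Nat.cast : ℕ → ℂ)
    let E : ℕ → Set (Fin n → ℂ) := fun d => {x | ∀ y : ℂ,
      g (Fin.cons y x) = ∑ k ∈ Finset.range d, g (Fin.cons (k : ℂ) x) * (L d k).eval y}
    have hclosed : ∀ d, IsClosed (E d) := by
      intro d
      simp only [E, ofPred_forall]
      refine isClosed_iInter fun y => isClosed_eq
        (hcons.comp (f := fun x => (y, x)) (by fun_prop)) ?_
      exact continuous_finsetSum _ fun k _ =>
        (hcons.comp (f := fun x => ((k : ℂ), x)) (by fun_prop)).mul continuous_const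
    have hcover : ⋃ d, E d = univ := by
      refine eq_univ_of_forall fun x => ?_
      obtain ⟨p, hp⟩ := h (Fin.cons 0 x) 0
      simp only [Fin.update_cons_zero] at hp
      refine mem_iUnion.2 ⟨p.natDegree + 1, fun y => ?_⟩
      have hdeg : p.degree < (Finset.range (p.natDegree + 1)).card := by
        rw [Finset.card_range]
        exact Polynomial.degree_le_natDegree.trans_lt (by exact_mod_cast Nat.lt_succ_self _)
      have hinterp := congrArg (Polynomial.eval y)
        (Lagrange.eq_interpolate (v := (Nat.cast : ℕ → ℂ)) Nat.cast_injective.injOn hdeg)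
      simpa [Lagrange.interpolate_apply, Polynomial.eval_finsetSum, hp, L] using hinterp
    obtain ⟨d, x₀, hx₀⟩ := nonempty_interior_of_iUnion_of_closed hclosed hcover
    obtain ⟨ε, hε, hball⟩ := Metric.isOpen_iff.1 isOpen_interior x₀ hx₀
    have hall : ∀ x y, g (Fin.cons y x) =
        ∑ k ∈ Finset.range d, g (Fin.cons (k : ℂ) x) * (L d k).eval y := by
      intro x y
      have hpoly : P y = ∑ k ∈ Finset.range d, P k * MvPolynomial.C ((L d k).eval y) := by
        refine MvPolynomial.funext_set (fun i => Metric.ball (x₀ i) ε)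
          (fun i => infinite_of_mem_nhds _ (Metric.ball_mem_nhds _ hε)) fun x' hx' => ?_
        rw [← ball_pi x₀ hε] at hx'
        have := interior_subset (hball hx') y
        simpa [hP] using this
      simpa [hP] using congrArg (MvPolynomial.eval x) hpoly
    refine ⟨∑ k ∈ Finset.range d, MvPolynomial.rename Fin.succ (P k) *
      Polynomial.aeval (MvPolynomial.X 0) (L d k), fun z => ?_⟩
    rw [← Fin.cons_self_tail z, hall, map_sum]
    refine Finset.sum_congr rfl fun k _ => ?_
    rw [map_mul, MvPolynomial.eval_rename, hP]
    congr 1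
    rw [← MvPolynomial.coe_aeval_eq_eval, RingHom.coe_coe, ← Polynomial.aeval_algHom_apply]
    simp

end SeparatelyPolynomial

section Definability

namespace RStructure

variable (S : RStructure)

theorem univ_mem (d : ℕ) : (Set.univ : Set (Fin d → ℝ)) ∈ S.defin d := by
  simpa using S.algebraic_mem d 0

theorem iInter_mem {d : ℕ} {ι : Type*} [Finite ι] {A : ι → Set (Fin d → ℝ)}
    (hA : ∀ i, A i ∈ S.defin d) : ⋂ i, A i ∈ S.defin d := by
  classical
  have := Fintype.ofFinite ι
  have key : ∀ s : Finset ι, ⋂ i ∈ s, A i ∈ S.defin d := by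
    intro s
    induction s using Finset.induction_on with
    | empty => simpa using S.univ_mem d
    | insert a s _ ih =>
      rw [Finset.set_biInter_insert]
      exact S.inter_mem d _ _ (hA a) ih
  simpa using key Finset.univ

theorem eval_eq_mem {d : ℕ} (p q : MvPolynomial (Fin d) ℝ) :
    {x | MvPolynomial.eval x p = MvPolynomial.eval x q} ∈ S.defin d := by
  simpa [sub_eq_zero] using S.algebraic_mem d (p - q)

theorem proj_castAdd_mem {a k : ℕ} {A : Set (Fin (a + k) → ℝ)} (hA : A ∈ S.defin (a + k)) :
    (fun x : Fin (a + k) → ℝ => x ∘ Fin.castAdd k) '' A ∈ S.defin a := by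
  induction k with
  | zero =>
    have : (fun x : Fin (a + 0) → ℝ => x ∘ Fin.castAdd 0) = id := rfl
    rwa [this, Set.image_id]
  | succ k ih =>
    have := ih (S.proj_mem (a + k) A hA)
    rwa [Set.image_image] at this

/-- If the graph of `f` is definable, so is the set of squared moduli of the points at which the
restriction of a coordinate of `f` to a coordinate line takes a given value. -/
theorem normSq_fiber_mem {n m : ℕ} {f : (Fin n → ℂ) → (Fin m → ℂ)}
    (hgraph :
      {w : Fin ((n + n) + (m + m)) → ℝ | ∃ z : Fin n → ℂ,
        w = Fin.append (c2r z) (c2r (f z))} ∈ S.defin ((n + n) + (m + m)))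
    (z : Fin n → ℂ) (i : Fin n) (j : Fin m) (c : ℂ) :
    {x : Fin 1 → ℝ | x 0 ∈ Complex.normSq '' {t | f (Function.update z i t) j = c}} ∈
      S.defin 1 := by
  let reIn : Fin n → Fin (1 + ((n + n) + (m + m))) := fun k =>
    Fin.natAdd 1 (Fin.castAdd (m + m) (Fin.castAdd n k))
  let imIn : Fin n → Fin (1 + ((n + n) + (m + m))) := fun k =>
    Fin.natAdd 1 (Fin.castAdd (m + m) (Fin.natAdd n k))
  let reOut : Fin (1 + ((n + n) + (m + m))) :=
    Fin.natAdd 1 (Fin.natAdd (n + n) (Fin.castAdd m j))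
  let imOut : Fin (1 + ((n + n) + (m + m))) :=
    Fin.natAdd 1 (Fin.natAdd (n + n) (Fin.natAdd m j))
  let r : Fin (1 + ((n + n) + (m + m))) := Fin.castAdd _ 0
  have hprod := S.prod_mem 1 _ Set.univ _ (S.univ_mem 1) hgraph
  have hr := S.eval_eq_mem (MvPolynomial.X r)
    (MvPolynomial.X (reIn i) * MvPolynomial.X (reIn i) +
      MvPolynomial.X (imIn i) * MvPolynomial.X (imIn i))
  have hre := S.iInter_mem fun k : {k // k ≠ i} =>
    S.eval_eq_mem (MvPolynomial.X (reIn k)) (MvPolynomial.C (z k).re)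
  have him := S.iInter_mem fun k : {k // k ≠ i} =>
    S.eval_eq_mem (MvPolynomial.X (imIn k)) (MvPolynomial.C (z k).im)
  have hcre := S.eval_eq_mem (MvPolynomial.X reOut) (MvPolynomial.C c.re)
  have hcim := S.eval_eq_mem (MvPolynomial.X imOut) (MvPolynomial.C c.im)
  have hall := S.proj_castAdd_mem (S.inter_mem _ _ _ hprod (S.inter_mem _ _ _ hr
    (S.inter_mem _ _ _ hre (S.inter_mem _ _ _ him (S.inter_mem _ _ _ hcre hcim)))))
  convert hall using 1
  ext y
  simp only [MvPolynomial.eval_X, MvPolynomial.eval_C, map_add, map_mul, Set.mem_image,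
    Set.mem_inter_iff, Set.mem_ofPred_eq, Set.mem_iInter, Set.mem_univ, true_and, Subtype.forall]
  constructor
  · rintro ⟨t, ht, hty⟩
    refine ⟨Fin.append y (Fin.append (c2r (Function.update z i t))
      (c2r (f (Function.update z i t)))), ⟨⟨Function.update z i t, ?_⟩, ?_, ?_, ?_, ?_, ?_⟩, ?_⟩
    · ext l
      simp
    · simp [-Fin.natAdd_eq_addNat, r, reIn, imIn, c2r, ← hty, Complex.normSq_apply]
    · intro k hk
      simp [reIn, c2r, hk]
    · intro k hk
      simp [-Fin.natAdd_eq_addNat, imIn, c2r, hk]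
    · simp [reOut, c2r, ht]
    · simp [-Fin.natAdd_eq_addNat, imOut, c2r, ht]
    · ext l
      simp
  · rintro ⟨x, ⟨⟨z', hz'⟩, h1, h2, h3, h4, h5⟩, rfl⟩
    have hreIn : ∀ k, x (reIn k) = (z' k).re := fun k => by
      simpa [-Fin.natAdd_eq_addNat, c2r] using congrFun hz' (Fin.castAdd (m + m) (Fin.castAdd n k))
    have himIn : ∀ k, x (imIn k) = (z' k).im := fun k => by
      simpa [-Fin.natAdd_eq_addNat, c2r] using congrFun hz' (Fin.castAdd (m + m) (Fin.natAdd n k))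
    have hreOut : x reOut = (f z' j).re := by
      simpa [-Fin.natAdd_eq_addNat, c2r] using congrFun hz' (Fin.natAdd (n + n) (Fin.castAdd m j))
    have himOut : x imOut = (f z' j).im := by
      simpa [-Fin.natAdd_eq_addNat, c2r] using congrFun hz' (Fin.natAdd (n + n) (Fin.natAdd m j))
    have hupd : Function.update z i (z' i) = z' := by
      refine Function.update_eq_iff.2 ⟨rfl, fun k hk => Complex.ext ?_ ?_⟩
      · rw [← hreIn, h2 k hk]
      · rw [← himIn, h3 k hk]
    refine ⟨z' i, ?_, ?_⟩
    · rw [hupd]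
      exact Complex.ext (hreOut.symm.trans h4) (himOut.symm.trans h5)
    · rw [Complex.normSq_apply, ← hreIn, ← himIn]
      exact h1.symm

end RStructure

end Definability

/-- A holomorphic map `f : ℂ^n → ℂ^m` whose graph (viewed inside ℝ^{2(n+m)}) is definable
in an o-minimal structure containing all ℝ_an-definable sets has polynomial coordinates. -/
theorem definable_holomorphic_map_is_polynomial {n m : ℕ} (S : RStructure)
    (hmin : S.IsOMinimal)
    (hran : ∀ (d : ℕ) (A : Set (Fin d → ℝ)), IsRanDefinable A → A ∈ S.defin d)
    (f : (Fin n → ℂ) → (Fin m → ℂ)) (hf : Differentiable ℂ f)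
    (hgraph :
      {w : Fin ((n + n) + (m + m)) → ℝ | ∃ z : Fin n → ℂ,
        w = Fin.append (c2r z) (c2r (f z))} ∈ S.defin ((n + n) + (m + m))) :
    ∃ p : Fin m → MvPolynomial (Fin n) ℂ,
      ∀ (z : Fin n → ℂ) (j : Fin m), f z j = MvPolynomial.eval z (p j) := by
  have hcoord : ∀ j : Fin m, ∃ p : MvPolynomial (Fin n) ℂ, ∀ z, f z j = MvPolynomial.eval z p := by
    intro j
    have hfj : Differentiable ℂ fun z => f z j := differentiable_pi.1 hf j
    refine hfj.continuous.exists_mvPolynomial_of_separately fun z i => ?_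
    refine (hfj.comp fun t => (hasFDerivAt_update z t).differentiableAt).exists_polynomial_of_fibers
      fun c => ?_
    have h := (hmin _).1 (S.normSq_fiber_mem hgraph z i j c)
    convert h using 1
    ext s
    exact ⟨fun hs => ⟨fun _ => s, hs, rfl⟩, by rintro ⟨x, hx, rfl⟩; exact hx⟩
  choose p hp using hcoord
  exact ⟨p, fun z j => hp j z⟩
end

section
/- Let n ≥ 1 and let X be a compact Hausdorff topological space equipped with a real-analytic atlas with corners: a family of homeomorphisms φ_i : U_i → V_i (i ∈ I), where U_i is an open subset of a quadrant ℝ^n_{k_i} = [0,∞)^{k_i} × ℝ^{n−k_i}, V_i is an open subset of X, X = ∪_{i ∈ I} V_i, and for all i, j ∈ I the transition map φ_j⁻¹ ∘ φ_i, defined on φ_i⁻¹(V_i ∩ V_j), extends to a real-analytic map on an open neighbourhood of φ_i⁻¹(V_i ∩ V_j) in ℝ^n. Then there exist a finite subset F ⊆ I and, for each i ∈ F, a bounded open semialgebraic subset U'_i ⊆ U_i, such that X = ∪_{i ∈ F} φ_i(U'_i) and, for all i, j ∈ F, the transition map φ_j⁻¹ ∘ φ_i restricted to U'_i ∩ φ_i⁻¹(φ_i(U'_i)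 ∩ φ_j(U'_j)) is ℝ_an-definable. -/
/-- The quadrant `ℝ^n_k = [0,∞)^k × ℝ^{n-k}` (first `k` coordinates nonnegative). -/
def quadrant (n kk : ℕ) : Set (Fin n → ℝ) :=
  {x | ∀ j : Fin n, (j : ℕ) < kk → 0 ≤ x j}

namespace IsSemialgebraic

variable {m : ℕ} {A B : Set (Fin m → ℝ)}

theorem basic (p : MvPolynomial (Fin m) ℝ) {r : ℕ} (q : Fin r → MvPolynomial (Fin m) ℝ) :
    IsSemialgebraic {x | MvPolynomial.eval x p = 0 ∧ ∀ j, 0 < MvPolynomial.eval x (q j)} :=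
  ⟨1, fun _ => _, fun _ => ⟨p, r, q, rfl⟩, (Set.iUnion_const _).symm⟩

theorem setOf_eval_eq_zero (p : MvPolynomial (Fin m) ℝ) :
    IsSemialgebraic {x | MvPolynomial.eval x p = 0} := by
  simpa using basic p Fin.elim0

theorem setOf_eval_pos (q : MvPolynomial (Fin m) ℝ) :
    IsSemialgebraic {x | 0 < MvPolynomial.eval x q} := by
  simpa using basic 0 (fun _ : Fin 1 => q)

protected theorem empty : IsSemialgebraic (∅ : Set (Fin m → ℝ)) := by
  simpa using setOf_eval_eq_zero (1 : MvPolynomial (Fin m) ℝ)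

protected theorem univ : IsSemialgebraic (Set.univ : Set (Fin m → ℝ)) := by
  simpa using setOf_eval_eq_zero (0 : MvPolynomial (Fin m) ℝ)

protected theorem union (hA : IsSemialgebraic A) (hB : IsSemialgebraic B) :
    IsSemialgebraic (A ∪ B) := by
  obtain ⟨k, C, hC, rfl⟩ := hA
  obtain ⟨l, D, hD, rfl⟩ := hB
  refine ⟨k + l, Fin.append C D, fun i => ?_, ?_⟩
  · refine Fin.addCases (fun i => ?_) (fun i => ?_) i
    · simpa only [Fin.append_left] using hC i
    · simpa only [Fin.append_right] using hD i
  · ext x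
    simp only [Set.mem_union, Set.mem_iUnion]
    constructor
    · rintro (⟨i, hi⟩ | ⟨i, hi⟩)
      · exact ⟨Fin.castAdd l i, by simpa only [Fin.append_left] using hi⟩
      · exact ⟨Fin.natAdd k i, by simpa only [Fin.append_right] using hi⟩
    · rintro ⟨i, hi⟩
      induction i using Fin.addCases with
      | left i => exact .inl ⟨i, by simpa only [Fin.append_left] using hi⟩
      | right i => exact .inr ⟨i, by simpa only [Fin.append_right] using hi⟩

protected theorem inter (hA : IsSemialgebraic A) (hB : IsSemialgebraic B) :
    IsSemialgebraic (A ∩ B) := by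
  obtain ⟨k, C, hC, rfl⟩ := hA
  obtain ⟨l, D, hD, rfl⟩ := hB
  refine ⟨k * l, fun i => C (finProdFinEquiv.symm i).1 ∩ D (finProdFinEquiv.symm i).2,
    fun i => ?_, ?_⟩
  · obtain ⟨p, r, q, h⟩ := hC (finProdFinEquiv.symm i).1
    obtain ⟨p', r', q', h'⟩ := hD (finProdFinEquiv.symm i).2
    refine ⟨p * p + p' * p', r + r', Fin.append q q', ?_⟩
    ext x
    simp only [h, h', Set.mem_inter_iff, Set.mem_ofPred_eq, map_add, map_mul,
      mul_self_add_mul_self_eq_zero, Fin.forall_fin_add, Fin.append_left, Fin.append_right]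
    tauto
  · rw [Set.iUnion_inter_iUnion, finProdFinEquiv.symm.surjective.iUnion_comp
      (fun z => C z.1 ∩ D z.2), Set.iUnion_prod']

theorem biUnion_finset {ι : Type*} (s : Finset ι) {f : ι → Set (Fin m → ℝ)}
    (hf : ∀ i ∈ s, IsSemialgebraic (f i)) : IsSemialgebraic (⋃ i ∈ s, f i) := by
  classical
  induction s using Finset.induction_on with
  | empty => simpa using IsSemialgebraic.empty
  | insert a s _ ih =>
    rw [Finset.set_biUnion_insert]
    exact (hf a (Finset.mem_insert_self a s)).union
      (ih fun i hi => hf i (Finset.mem_insert_of_mem hi))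

theorem biInter_finset {ι : Type*} (s : Finset ι) {f : ι → Set (Fin m → ℝ)}
    (hf : ∀ i ∈ s, IsSemialgebraic (f i)) : IsSemialgebraic (⋂ i ∈ s, f i) := by
  classical
  induction s using Finset.induction_on with
  | empty => simpa using IsSemialgebraic.univ
  | insert a s _ ih =>
    rw [Finset.set_biInter_insert]
    exact (hf a (Finset.mem_insert_self a s)).inter
      (ih fun i hi => hf i (Finset.mem_insert_of_mem hi))

protected theorem iInter {ι : Type*} [Fintype ι] {f : ι → Set (Fin m → ℝ)}
    (hf : ∀ i, IsSemialgebraic (f i)) : IsSemialgebraic (⋂ i, f i) := by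
  simpa using biInter_finset Finset.univ fun i _ => hf i

protected theorem ball (c : Fin m → ℝ) {r : ℝ} (hr : 0 < r) :
    IsSemialgebraic (Metric.ball c r) := by
  have h : Metric.ball c r = ⋂ l : Fin m,
      {x | 0 < MvPolynomial.eval x (MvPolynomial.X l - MvPolynomial.C (c l - r))} ∩
      {x | 0 < MvPolynomial.eval x (MvPolynomial.C (c l + r) - MvPolynomial.X l)} := by
    ext x
    simp only [Metric.mem_ball, dist_pi_lt_iff hr, Real.dist_eq, abs_lt, Set.mem_iInter,
      Set.mem_inter_iff, Set.mem_ofPred_eq, map_sub, MvPolynomial.eval_X, MvPolynomial.eval_C]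
    refine forall_congr' fun l => and_congr ?_ ?_ <;> constructor <;> intro <;> linarith
  rw [h]
  exact .iInter fun l => (setOf_eval_pos _).inter (setOf_eval_pos _)

protected theorem quadrant (n k : ℕ) : IsSemialgebraic (quadrant n k) := by
  have h : quadrant n k = ⋂ j : Fin n, {x | (j : ℕ) < k → 0 ≤ x j} := by
    ext x
    simp [quadrant]
  rw [h]
  refine .iInter fun j => ?_
  by_cases hj : (j : ℕ) < k
  · convert (setOf_eval_pos (MvPolynomial.X j)).union (setOf_eval_eq_zero (MvPolynomial.X j))
      using 1
    ext x
    simp [hj, le_iff_lt_or_eq, eq_comm]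
  · simpa [hj] using IsSemialgebraic.univ

end IsSemialgebraic

namespace RStructure

variable (S : RStructure) {m N : ℕ}

theorem univ_mem_s9 (m : ℕ) : Set.univ ∈ S.defin m := by
  simpa using S.algebraic_mem m 0

theorem empty_mem (m : ℕ) : ∅ ∈ S.defin m := by
  simpa using S.algebraic_mem m 1

theorem biUnion_finset_mem {ι : Type*} (s : Finset ι) {f : ι → Set (Fin m → ℝ)}
    (hf : ∀ i ∈ s, f i ∈ S.defin m) : (⋃ i ∈ s, f i) ∈ S.defin m := by
  classical
  induction s using Finset.induction_on with
  | empty => simpa using S.empty_mem m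
  | insert a s _ ih =>
    rw [Finset.set_biUnion_insert]
    exact S.union_mem _ _ _ (hf a (Finset.mem_insert_self a s))
      (ih fun i hi => hf i (Finset.mem_insert_of_mem hi))

theorem iInter_mem_s9 {ι : Type*} [Fintype ι] {f : ι → Set (Fin m → ℝ)}
    (hf : ∀ i, f i ∈ S.defin m) : (⋂ i, f i) ∈ S.defin m := by
  have h := S.compl_mem _ _ (S.biUnion_finset_mem Finset.univ
    fun i _ => S.compl_mem _ _ (hf i))
  simpa using h

theorem proj_add_mem (A : Set (Fin (N + m) → ℝ)) (hA : A ∈ S.defin (N + m)) :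
    (fun x : Fin (N + m) → ℝ => x ∘ Fin.castAdd m) '' A ∈ S.defin N := by
  induction m with
  | zero =>
    have h : (fun x : Fin (N + 0) → ℝ => x ∘ Fin.castAdd 0) = id := rfl
    rwa [h, Set.image_id]
  | succ m ih =>
    have h := ih _ (S.proj_mem (N + m) A hA)
    rwa [Set.image_image] at h

/-- Definable sets are stable under preimages by polynomial maps. -/
theorem preimage_mem (P : Fin m → MvPolynomial (Fin N) ℝ) {A : Set (Fin m → ℝ)}
    (hA : A ∈ S.defin m) :
    {x | (fun i => MvPolynomial.eval x (P i)) ∈ A} ∈ S.defin N := by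
  have hprod := S.prod_mem N m _ _ (S.univ_mem_s9 N) hA
  have hgraph := S.iInter_mem_s9 fun i : Fin m => S.algebraic_mem (N + m)
    (MvPolynomial.X (Fin.natAdd N i) - MvPolynomial.rename (Fin.castAdd m) (P i))
  convert S.proj_add_mem _ (S.inter_mem _ _ _ hprod hgraph) using 1
  ext x
  simp only [Set.mem_ofPred_eq, Set.mem_image, Set.mem_inter_iff, Set.mem_univ, true_and,
    Set.mem_iInter, map_sub, MvPolynomial.eval_X, MvPolynomial.eval_rename, sub_eq_zero]
  constructor
  · intro hx
    have h : Fin.append x (fun i => MvPolynomial.eval x (P i)) ∘ Fin.castAdd m = x := by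
      ext i
      simp
    exact ⟨Fin.append x fun i => MvPolynomial.eval x (P i), ⟨by simpa using hx, by simp [h]⟩, h⟩
  · rintro ⟨z, ⟨hz, hz'⟩, rfl⟩
    simpa only [hz'] using hz

/-- The graph of a function analytic near a closed ball is definable over the open ball. -/
theorem HasRan.graph_analytic_ball_mem {S : RStructure} (hS : S.HasRan)
    {O : Set (Fin m → ℝ)} (hO : IsOpen O) {g : (Fin m → ℝ) → Fin N → ℝ}
    (hg : AnalyticOnNhd ℝ g O) (c : Fin m → ℝ) {r : ℝ} (hr : 0 < r)
    (hcr : Metric.closedBall c r ⊆ O) :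
    {w : Fin (m + N) → ℝ | w ∘ Fin.castAdd N ∈ Metric.ball c r ∧
      w ∘ Fin.natAdd m = g (w ∘ Fin.castAdd N)} ∈ S.defin (m + N) := by
  classical
  let a : (Fin m → ℝ) → Fin m → ℝ := fun t l => c l - r + 2 * r * t l
  have ha : AnalyticOnNhd ℝ a Set.univ := by
    rw [analyticOnNhd_pi_iff]
    intro l
    exact (analyticOnNhd_const.add (analyticOnNhd_const.mul
      ((ContinuousLinearMap.proj (R := ℝ) (φ := fun _ : Fin m => ℝ) l).analyticOnNhd _)))
  have haO : Set.Icc (0 : Fin m → ℝ) 1 ⊆ a ⁻¹' O := by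
    rintro t ⟨ht0, ht1⟩
    refine hcr ?_
    rw [Metric.mem_closedBall, dist_pi_le_iff hr.le]
    intro l
    have h0 : 0 ≤ t l := ht0 l
    have h1 : t l ≤ 1 := ht1 l
    rw [Real.dist_eq, abs_le]
    constructor <;> simp only [a] <;> nlinarith
  let f : Fin N → (Fin m → ℝ) → ℝ := fun l =>
    (Set.Icc (0 : Fin m → ℝ) 1).indicator fun t => g (a t) l
  have hf : ∀ l, IsRestrictedAnalytic (f l) := fun l =>
    ⟨fun t ht => Set.indicator_of_notMem ht _, a ⁻¹' O, fun t => g (a t) l,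
      hO.preimage (continuousOn_univ.mp ha.continuousOn), haO,
      ((analyticOnNhd_pi_iff.mp hg) l).comp (ha.mono (Set.subset_univ _)) fun _ h => h,
      fun t ht => Set.indicator_of_mem ht _⟩
  have hball := S.preimage_mem (fun i => MvPolynomial.X (Fin.castAdd N i))
    (hS.1 _ _ (IsSemialgebraic.ball c hr))
  have hgraph := S.iInter_mem_s9 fun l : Fin N => S.preimage_mem
    (Fin.snoc (α := fun _ => MvPolynomial (Fin (m + N)) ℝ)
      (fun i : Fin m => MvPolynomial.C (2 * r)⁻¹ *
        (MvPolynomial.X (Fin.castAdd N i) - MvPolynomial.C (c i - r)))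
      (MvPolynomial.X (Fin.natAdd m l))) (hS.2 _ _ (hf l))
  convert S.inter_mem _ _ _ hball hgraph using 1
  ext w
  simp only [Set.mem_ofPred_eq, Set.mem_inter_iff, Set.mem_iInter, graphSet, Fin.snoc_last,
    MvPolynomial.eval_X]
  refine and_congr_right fun hw => ?_
  rw [Metric.mem_ball, dist_pi_lt_iff hr] at hw
  have hr2 : 2 * r ≠ 0 := by positivity
  have hs : (fun i => (2 * r)⁻¹ * (w (Fin.castAdd N i) - (c i - r))) ∈
      Set.Icc (0 : Fin m → ℝ) 1 := by
    have h l := abs_lt.mp (Real.dist_eq _ _ ▸ hw l)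
    constructor <;> intro l <;> have := h l <;> simp only [Function.comp_apply] at this
    · exact mul_nonneg (by positivity) (by linarith)
    · rw [Pi.one_apply, inv_mul_le_iff₀ (by positivity)]
      linarith
  have has : a (fun i => (2 * r)⁻¹ * (w (Fin.castAdd N i) - (c i - r))) =
      w ∘ Fin.castAdd N := by
    ext l
    simp only [a, Function.comp_apply]
    rw [mul_inv_cancel_left₀ hr2]
    ring
  rw [funext_iff]
  refine forall_congr' fun l => ?_
  have hfl := Set.indicator_of_mem hs fun t => g (a t) l
  rw [has] at hfl
  rw [← hfl]
  simp only [Function.comp_def, Fin.snoc_castSucc, map_mul, map_sub, MvPolynomial.eval_X,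
    MvPolynomial.eval_C, f]

end RStructure


/-- A compact Hausdorff space equipped with a real-analytic atlas with corners admits a
finite subatlas with bounded, (relatively) open, semialgebraic chart domains, still
covering the space, whose transition maps are ℝ_an-definable.

The charts are encoded as follows: `φ i` restricted to the domain `U i` (an open subset of
the quadrant `ℝ^n_{k i}`) is a homeomorphism onto the open set `φ i '' U i ⊆ X`, with
(partial) inverse `ψ i`; the transition map `φ_j⁻¹ ∘ φ_i` is `ψ j ∘ φ i`; it is assumed to
extend to a real-analytic map on an open neighbourhood of its domain. Definability of a
map is expressed by definability of its graph inside ℝ^{n+n}. -/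
theorem compact_analytic_manifold_with_corners_has_definable_atlas
    {n : ℕ} (hn : 1 ≤ n)
    (X : Type) [TopologicalSpace X] [CompactSpace X] [T2Space X]
    (I : Type) (k : I → ℕ) (hk : ∀ i, k i ≤ n)
    (U : I → Set (Fin n → ℝ))
    (φ : I → (Fin n → ℝ) → X) (ψ : I → X → (Fin n → ℝ))
    -- `U i` is an open subset of the quadrant `ℝ^n_{k i}`
    (hUopen : ∀ i, ∃ O : Set (Fin n → ℝ), IsOpen O ∧ U i = O ∩ quadrant n (k i))
    -- `φ i : U i → φ i '' U i` is a homeomorphism onto an open subset of `X`,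
    -- with inverse `ψ i`
    (hφcont : ∀ i, ContinuousOn (φ i) (U i))
    (hφinj : ∀ i, Set.InjOn (φ i) (U i))
    (hVopen : ∀ i, IsOpen (φ i '' U i))
    (hψcont : ∀ i, ContinuousOn (ψ i) (φ i '' U i))
    (hψφ : ∀ i, ∀ x ∈ U i, ψ i (φ i x) = x)
    (hφψ : ∀ i, ∀ p ∈ φ i '' U i, φ i (ψ i p) = p)
    -- the charts cover `X`
    (hcover : ∀ p : X, ∃ i, p ∈ φ i '' U i)
    -- each transition map extends to a real-analytic map on an open neighbourhood of
    -- its domain `φ_i⁻¹(V_i ∩ V_j) = {x ∈ U i | φ i x ∈ φ j '' U j}`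
    (htrans : ∀ i j, ∃ (O : Set (Fin n → ℝ)) (g : (Fin n → ℝ) → (Fin n → ℝ)),
      IsOpen O ∧ {x ∈ U i | φ i x ∈ φ j '' U j} ⊆ O ∧ AnalyticOnNhd ℝ g O ∧
      ∀ x ∈ {x ∈ U i | φ i x ∈ φ j '' U j}, g x = ψ j (φ i x)) :
    ∃ (F : Finset I) (U' : I → Set (Fin n → ℝ)),
      (∀ i ∈ F, U' i ⊆ U i) ∧
      -- each `U' i` is bounded
      (∀ i ∈ F, Bornology.IsBounded (U' i)) ∧
      -- each `U' i` is open in `U i`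
      (∀ i ∈ F, ∃ O : Set (Fin n → ℝ), IsOpen O ∧ U' i = O ∩ U i) ∧
      -- each `U' i` is semialgebraic
      (∀ i ∈ F, IsSemialgebraic (U' i)) ∧
      -- the restricted charts still cover `X`
      (∀ p : X, ∃ i ∈ F, p ∈ φ i '' U' i) ∧
      -- the transition maps, restricted to `U'_i ∩ φ_i⁻¹(φ_i(U'_i) ∩ φ_j(U'_j))`,
      -- are ℝ_an-definable (their graphs are ℝ_an-definable subsets of ℝ^{n+n})
      (∀ i ∈ F, ∀ j ∈ F, IsRanDefinable
        {w : Fin (n + n) → ℝ | ∃ x ∈ {x ∈ U' i | φ i x ∈ φ j '' U' j},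
          w = Fin.append x (ψ j (φ i x))}) := by
  classical
  choose OU hOU hU using hUopen
  choose O g hO hDO hg hgeq using htrans
  choose i hi using hcover
  have hxU : ∀ p, ψ (i p) p ∈ U (i p) := fun p => by
    obtain ⟨x, hx, hxp⟩ := hi p
    have hψx := hψφ _ x hx
    rw [hxp] at hψx
    rwa [hψx]
  have hball : ∀ p, ∃ r > 0, Metric.closedBall (ψ (i p) p) r ⊆ OU (i p) := fun p =>
    Metric.nhds_basis_closedBall.mem_iff.mp
      ((hOU (i p)).mem_nhds ((hU (i p) ▸ hxU p : _ ∈ OU (i p) ∩ _).1))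
  choose r hr hrO using hball
  obtain ⟨T, -, hT⟩ := isCompact_univ.elim_nhds_subcover
    (fun p => φ (i p) '' U (i p) ∩ ψ (i p) ⁻¹' Metric.ball (ψ (i p) p) (r p)) fun p _ =>
      ((hψcont _).isOpen_inter_preimage (hVopen _) Metric.isOpen_ball).mem_nhds
        ⟨hi p, Metric.mem_ball_self (hr p)⟩
  let B : I → Set (Fin n → ℝ) := fun a =>
    ⋃ p ∈ T.filter fun p => i p = a, Metric.ball (ψ (i p) p) (r p)
  let C : I → Set (Fin n → ℝ) := fun a =>
    ⋃ p ∈ T.filter fun p => i p = a, Metric.closedBall (ψ (i p) p) (r p)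
  have hBC : ∀ a, B a ⊆ C a := fun a => Set.iUnion₂_mono fun p _ => Metric.ball_subset_closedBall
  have hCO : ∀ a, C a ⊆ OU a := fun a => Set.iUnion₂_subset fun p hp => by
    obtain rfl := (Finset.mem_filter.mp hp).2
    exact hrO p
  have hBopen : ∀ a, IsOpen (B a) := fun a => isOpen_biUnion fun _ _ => Metric.isOpen_ball
  have hCcomp : ∀ a, IsCompact (C a) := fun a =>
    (Finset.isCompact_biUnion _) fun _ _ => isCompact_closedBall _ _
  have hqclosed : ∀ a, IsClosed (quadrant n (k a)) := fun a => by
    simp only [quadrant, Set.ofPred_forall]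
    exact isClosed_iInter fun j => isClosed_iInter fun _ =>
      isClosed_le continuous_const (continuous_apply j)
  have hKcomp : ∀ a, IsCompact (C a ∩ quadrant n (k a)) := fun a =>
    (hCcomp a).inter_right (hqclosed a)
  have hKU : ∀ a, C a ∩ quadrant n (k a) ⊆ U a := fun a => by
    rw [hU a]
    exact Set.inter_subset_inter_left _ (hCO a)
  have hBK : ∀ a, B a ∩ quadrant n (k a) ⊆ C a ∩ quadrant n (k a) := fun a =>
    Set.inter_subset_inter_left _ (hBC a)
  have hsemi : ∀ a, IsSemialgebraic (B a ∩ quadrant n (k a)) := fun a =>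
    (IsSemialgebraic.biUnion_finset _ fun p _ => .ball _ (hr p)).inter (.quadrant _ _)
  refine ⟨T.image i, fun a => B a ∩ quadrant n (k a), fun a _ => (hBK a).trans (hKU a),
    fun a _ => (hKcomp a).isBounded.subset (hBK a), fun a _ => ⟨B a, hBopen a, ?_⟩,
    fun a _ => hsemi a, fun p => ?_, fun a _ b _ S hS => ?_⟩
  · rw [hU a, ← Set.inter_assoc, Set.inter_eq_left.mpr ((hBC a).trans (hCO a))]
  · obtain ⟨q, hq, hp, hpq⟩ := Set.mem_iUnion₂.mp (hT (Set.mem_univ p))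
    refine ⟨i q, Finset.mem_image_of_mem i hq, ψ (i q) p, ⟨?_, ?_⟩, hφψ _ p hp⟩
    · exact Set.mem_iUnion₂.mpr ⟨q, Finset.mem_filter.mpr ⟨hq, rfl⟩, hpq⟩
    · obtain ⟨x, hx, rfl⟩ := hp
      rw [hψφ _ x hx]
      exact (hU (i q) ▸ hx : x ∈ OU (i q) ∩ _).2
  · let L : Set (Fin n → ℝ) :=
      C a ∩ quadrant n (k a) ∩ φ a ⁻¹' (φ b '' (C b ∩ quadrant n (k b)))
    have hL : IsCompact L :=
      (hKcomp a).of_isClosed_subset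
        (((hφcont a).mono (hKU a)).preimage_isClosed_of_isClosed (hKcomp a).isClosed
          ((hKcomp b).image_of_continuousOn ((hφcont b).mono (hKU b))).isClosed)
        Set.inter_subset_left
    have hLD : ∀ x ∈ L, x ∈ {x ∈ U a | φ a x ∈ φ b '' U b} := fun x hx =>
      ⟨hKU a hx.1, Set.image_mono (hKU b) hx.2⟩
    obtain ⟨G, hG, hGD⟩ := continuousOn_iff'.mp (hφcont a) _ (hVopen b)
    have hloc : ∀ x ∈ L, ∃ ρ > 0, Metric.closedBall x ρ ⊆ O a b ∩ (G ∩ OU a) := fun x hx => by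
      have hxD := hLD x hx
      refine Metric.nhds_basis_closedBall.mem_iff.mp
        (((hO a b).inter (hG.inter (hOU a))).mem_nhds ⟨hDO a b hxD, ?_, hCO a hx.1.1⟩)
      exact (hGD ▸ ⟨hxD.2, hxD.1⟩ : x ∈ G ∩ U a).1
    choose! ρ hρ hρO using hloc
    obtain ⟨Q, hQL, hQ⟩ := hL.elim_nhds_subcover (fun x => Metric.ball x (ρ x)) fun x hx =>
      Metric.ball_mem_nhds x (hρ x hx)
    have hdom := S.prod_mem n n _ _ (hS.1 _ _ (hsemi a)) (hS.1 _ _ (hsemi b))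
    have hgraph := S.biUnion_finset_mem Q fun x hx =>
      hS.graph_analytic_ball_mem (hO a b) (hg a b) x (hρ x (hQL x hx))
        ((hρO x (hQL x hx)).trans Set.inter_subset_left)
    convert S.inter_mem _ _ _ hdom hgraph using 1
    ext w
    constructor
    · rintro ⟨x, ⟨hx, y, hy, hyx⟩, rfl⟩
      have hyU := hKU b (hBK b hy)
      have hxL : x ∈ L := ⟨hBK a hx, y, hBK b hy, hyx⟩
      obtain ⟨z, hz, hxz⟩ := Set.mem_iUnion₂.mp (hQ hxL)
      have h1 : Fin.append x (ψ b (φ a x)) ∘ Fin.castAdd n = x := by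
        ext l
        exact Fin.append_left _ _ l
      have h2 : Fin.append x (ψ b (φ a x)) ∘ Fin.natAdd n = ψ b (φ a x) := by
        ext l
        exact Fin.append_right _ _ l
      have hψy : ψ b (φ a x) = y := by rw [← hyx, hψφ b y hyU]
      refine ⟨⟨Set.mem_of_eq_of_mem h1 hx, Set.mem_of_eq_of_mem (h2.trans hψy) hy⟩,
        Set.mem_iUnion₂.mpr ⟨z, hz, ?_⟩⟩
      · rw [Set.mem_ofPred_eq, h1, h2]
        exact ⟨hxz, (hgeq a b x (hLD x hxL)).symm⟩
    · rintro ⟨⟨hx, hy⟩, hw⟩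
      obtain ⟨z, hz, hxz, hyx⟩ := Set.mem_iUnion₂.mp hw
      have hxO := hρO z (hQL z hz) (Metric.ball_subset_closedBall hxz)
      have hxU := hKU a (hBK a hx)
      have hxD : w ∘ Fin.castAdd n ∈ {x ∈ U a | φ a x ∈ φ b '' U b} :=
        ⟨hxU, (hGD.symm ▸ ⟨hxO.2.1, hxU⟩ :
          w ∘ Fin.castAdd n ∈ φ a ⁻¹' (φ b '' U b) ∩ U a).1⟩
      have hψ : ψ b (φ a (w ∘ Fin.castAdd n)) = w ∘ Fin.natAdd n := by
        rw [hyx, hgeq a b _ hxD]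
      refine ⟨w ∘ Fin.castAdd n, ⟨hx, w ∘ Fin.natAdd n, hy, ?_⟩, ?_⟩
      · rw [← hψ, hφψ b _ hxD.2]
      · rw [hψ]
        exact (Fin.append_castAdd_natAdd (f := w)).symm
end
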